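/- arXiv:0811.2256 — 2 statements merged into one kernel-verified Lean document; each statement's English description precedes it below -/
import Mathlib

section
/- Let f : ℝ→ℝ be a smooth strictly increasing bijection with f′(x) ≠ 0 for all x (the non-characteristic case), let φ, ψ : ℝ→ℝ be smooth, and let F : ℝ³→ℝ be smooth satisfying condition (H). Then there exists exactly one smooth function u : ℝ²→ℝ such that ∂²u/∂x∂y(x,y) = F(x,y,u(x,y)) for all (x,y) ∈ ℝ², u(x,f(x)) = φ(x) for all x, and ∂u/∂y(x,f(x)) = ψ(x) for all x. -/
open MeasureTheory Set Filter Topology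

/-- The primitive `y ↦ ∫ t in x..y, h x t` of the slice `h x`, based at the diagonal point `x`. -/
noncomputable def diagPrimitive (h : ℝ → ℝ → ℝ) (x y : ℝ) : ℝ := ∫ t in x..y, h x t

/-- The solution operator of `∂²u/∂x∂y = h` with zero Cauchy data on the diagonal. -/
noncomputable def diagDoublePrimitive (h : ℝ → ℝ → ℝ) : ℝ → ℝ → ℝ :=
  diagPrimitive fun x t => diagPrimitive (fun t s => h s t) t x

theorem Continuous.swap_args {h : ℝ → ℝ → ℝ} (hh : Continuous fun p : ℝ × ℝ => h p.1 p.2) :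
    Continuous fun p : ℝ × ℝ => h p.2 p.1 :=
  hh.comp continuous_swap

theorem Continuous.slice {h : ℝ → ℝ → ℝ} (hh : Continuous fun p : ℝ × ℝ => h p.1 p.2) (x : ℝ) :
    Continuous (h x) :=
  hh.comp (Continuous.prodMk_right x)

theorem diagPrimitive_self (h : ℝ → ℝ → ℝ) (x : ℝ) : diagPrimitive h x x = 0 :=
  intervalIntegral.integral_same

theorem diagPrimitive_eq_sub {h : ℝ → ℝ → ℝ} (hh : Continuous fun p : ℝ × ℝ => h p.1 p.2)
    (x y : ℝ) :
    diagPrimitive h x y = (∫ t in (0 : ℝ)..y, h x t) - ∫ t in (0 : ℝ)..x, h x t :=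
  (intervalIntegral.integral_interval_sub_left ((hh.slice x).intervalIntegrable _ _)
    ((hh.slice x).intervalIntegrable _ _)).symm

theorem continuous_integral_zero_slice {h : ℝ → ℝ → ℝ}
    (hh : Continuous fun p : ℝ × ℝ => h p.1 p.2) :
    Continuous fun p : ℝ × ℝ => ∫ t in (0 : ℝ)..p.2, h p.1 t :=
  intervalIntegral.continuous_parametric_intervalIntegral_of_continuous
    (f := fun (p : ℝ × ℝ) t => h p.1 t) (by
      exact hh.comp ((continuous_fst.comp continuous_fst).prodMk continuous_snd)) continuous_snd

theorem continuous_diagPrimitive {h : ℝ → ℝ → ℝ} (hh : Continuous fun p : ℝ × ℝ => h p.1 p.2) :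
    Continuous fun p : ℝ × ℝ => diagPrimitive h p.1 p.2 := by
  simp only [diagPrimitive_eq_sub hh]
  exact (continuous_integral_zero_slice hh).sub
    ((continuous_integral_zero_slice hh).comp (continuous_fst.prodMk continuous_fst))

theorem hasDerivAt_diagPrimitive {h : ℝ → ℝ → ℝ}
    (hh : Continuous fun p : ℝ × ℝ => h p.1 p.2) (x y : ℝ) :
    HasDerivAt (diagPrimitive h x) (h x y) y :=
  (hh.slice x).integral_hasStrictDerivAt x y |>.hasDerivAt

/-- Leibniz rule for an integral with a parameter and a variable end point. -/
theorem hasFDerivAt_integral_zero_slice {h h' : ℝ → ℝ → ℝ}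
    (hh : Continuous fun p : ℝ × ℝ => h p.1 p.2) (hh' : Continuous fun p : ℝ × ℝ => h' p.1 p.2)
    (hd : ∀ x t, HasDerivAt (fun s => h s t) (h' x t) x) (p : ℝ × ℝ) :
    HasFDerivAt (fun q : ℝ × ℝ => ∫ t in (0 : ℝ)..q.2, h q.1 t)
      ((∫ t in (0 : ℝ)..p.2, h' p.1 t) • ContinuousLinearMap.fst ℝ ℝ ℝ +
        h p.1 p.2 • ContinuousLinearMap.snd ℝ ℝ ℝ) p := by
  have hx : ∀ x y : ℝ, HasDerivAt (fun s => ∫ t in (0 : ℝ)..y, h s t)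
      (∫ t in (0 : ℝ)..y, h' x t) x := by
    intro x y
    obtain ⟨C, hC⟩ := ((isCompact_closedBall x 1).prod (isCompact_uIcc (a := (0 : ℝ)) (b := y))
      ).exists_bound_of_continuousOn hh'.continuousOn
    refine (intervalIntegral.hasDerivAt_integral_of_dominated_loc_of_deriv_le
      (s := Metric.closedBall x 1) (bound := fun _ => C) (F' := h')
      (Metric.closedBall_mem_nhds x one_pos) ?_ ?_ ?_ ?_ ?_ ?_).2
    · exact Eventually.of_forall fun s => (hh.slice s).aestronglyMeasurable
    · exact (hh.slice x).intervalIntegrable _ _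
    · exact (hh'.slice x).aestronglyMeasurable
    · exact Eventually.of_forall fun t ht s hs => hC (s, t) ⟨hs, uIoc_subset_uIcc ht⟩
    · exact intervalIntegrable_const
    · exact Eventually.of_forall fun t _ s _ => hd s t
  have key := hasStrictFDerivAt_uncurry_coprod (𝕜 := ℝ) (u := p)
    (f := fun x y => ∫ t in (0 : ℝ)..y, h x t)
    (f₁ := fun x y => ContinuousLinearMap.toSpanSingleton ℝ (∫ t in (0 : ℝ)..y, h' x t))
    (f₂ := fun x y => ContinuousLinearMap.toSpanSingleton ℝ (h x y))
    (Eventually.of_forall fun v => (hx v.1 v.2).hasFDerivAt)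
    (Eventually.of_forall fun v =>
      ((hh.slice v.1).integral_hasStrictDerivAt 0 v.2).hasDerivAt.hasFDerivAt)
    (by
      have := continuous_integral_zero_slice hh'
      exact ((ContinuousLinearMap.toSpanSingletonCLE (𝕜 := ℝ) (E := ℝ)).continuous.comp
        this).continuousAt)
    (((ContinuousLinearMap.toSpanSingletonCLE (𝕜 := ℝ) (E := ℝ)).continuous.comp hh).continuousAt)
  refine key.hasFDerivAt.congr_fderiv ?_
  ext <;> simp [Function.HasUncurry.uncurry]

theorem contDiff_integral_zero_slice (n : ℕ) {h : ℝ → ℝ → ℝ}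
    (hh : ContDiff ℝ n fun p : ℝ × ℝ => h p.1 p.2) :
    ContDiff ℝ n fun p : ℝ × ℝ => ∫ t in (0 : ℝ)..p.2, h p.1 t := by
  induction n generalizing h with
  | zero =>
    rw [Nat.cast_zero, contDiff_zero] at hh ⊢
    exact continuous_integral_zero_slice hh
  | succ n ih =>
    rw [Nat.cast_succ] at hh ⊢
    set H : ℝ × ℝ → ℝ := fun p => h p.1 p.2
    have hD : ContDiff ℝ n fun p : ℝ × ℝ => fderiv ℝ H p (1, 0) :=
      (hh.fderiv_right le_rfl).clm_apply contDiff_const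
    have hd : ∀ x t, HasDerivAt (fun s => h s t) (fderiv ℝ H (x, t) (1, 0)) x := fun x t =>
      HasFDerivAt.comp_hasDerivAt (l := H) x ((hh.differentiable (by simp)) (x, t)).hasFDerivAt
        ((hasDerivAt_id' x).prodMk (hasDerivAt_const x t))
    refine contDiff_succ_iff_hasFDerivAt.2 ⟨_, ?_, hasFDerivAt_integral_zero_slice
      (h' := fun x t => fderiv ℝ H (x, t) (1, 0)) hh.continuous hD.continuous hd⟩
    exact ((ih (h := fun x t => fderiv ℝ H (x, t) (1, 0)) hD).smul contDiff_const).add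
      ((hh.of_le (by exact_mod_cast Nat.le_succ n)).smul contDiff_const)

theorem contDiff_diagPrimitive {n : ℕ} {h : ℝ → ℝ → ℝ}
    (hh : ContDiff ℝ n fun p : ℝ × ℝ => h p.1 p.2) :
    ContDiff ℝ n fun p : ℝ × ℝ => diagPrimitive h p.1 p.2 := by
  simp only [diagPrimitive_eq_sub hh.continuous]
  exact (contDiff_integral_zero_slice n hh).sub
    ((contDiff_integral_zero_slice n hh).comp (contDiff_fst.prodMk contDiff_fst))

theorem continuous_diagDoublePrimitive {h : ℝ → ℝ → ℝ}
    (hh : Continuous fun p : ℝ × ℝ => h p.1 p.2) :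
    Continuous fun p : ℝ × ℝ => diagDoublePrimitive h p.1 p.2 :=
  continuous_diagPrimitive (continuous_diagPrimitive hh.swap_args).swap_args

theorem hasDerivAt_diagDoublePrimitive {h : ℝ → ℝ → ℝ}
    (hh : Continuous fun p : ℝ × ℝ => h p.1 p.2) (x y : ℝ) :
    HasDerivAt (diagDoublePrimitive h x) (diagPrimitive (fun t s => h s t) y x) y :=
  hasDerivAt_diagPrimitive (h := fun x t => diagPrimitive (fun t s => h s t) t x)
    (continuous_diagPrimitive hh.swap_args).swap_args x y

theorem hasFDerivAt_diagDoublePrimitive {h : ℝ → ℝ → ℝ}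
    (hh : Continuous fun p : ℝ × ℝ => h p.1 p.2) (p : ℝ × ℝ) :
    HasFDerivAt (fun q : ℝ × ℝ => diagDoublePrimitive h q.1 q.2)
      (diagPrimitive h p.1 p.2 • ContinuousLinearMap.fst ℝ ℝ ℝ +
        diagPrimitive (fun t s => h s t) p.2 p.1 • ContinuousLinearMap.snd ℝ ℝ ℝ) p := by
  set A : ℝ → ℝ → ℝ := fun x t => diagPrimitive (fun t s => h s t) t x with hA
  have cA : Continuous fun p : ℝ × ℝ => A p.1 p.2 :=
    (continuous_diagPrimitive hh.swap_args).swap_args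
  have key := hasFDerivAt_integral_zero_slice (h := A) (h' := h) cA hh
    fun x t => hasDerivAt_diagPrimitive (h := fun t s => h s t) hh.swap_args t x
  have hdiag : HasFDerivAt (fun q : ℝ × ℝ => (q.1, q.1))
      ((ContinuousLinearMap.fst ℝ ℝ ℝ).prod (ContinuousLinearMap.fst ℝ ℝ ℝ)) p :=
    hasFDerivAt_fst.prodMk hasFDerivAt_fst
  have hsub := (key p).sub ((key (p.1, p.1)).comp p hdiag)
  have hfun : (fun q : ℝ × ℝ => diagDoublePrimitive h q.1 q.2) =
      (fun q : ℝ × ℝ => ∫ t in (0 : ℝ)..q.2, A q.1 t) -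
        (fun q : ℝ × ℝ => ∫ t in (0 : ℝ)..q.2, A q.1 t) ∘ fun q : ℝ × ℝ => (q.1, q.1) := by
    funext q
    exact diagPrimitive_eq_sub cA q.1 q.2
  rw [hfun]
  refine hsub.congr_fderiv ?_
  ext <;> simp [hA, diagPrimitive_self, diagPrimitive_eq_sub hh]

theorem contDiff_succ_diagDoublePrimitive {n : ℕ} {h : ℝ → ℝ → ℝ}
    (hh : ContDiff ℝ n fun p : ℝ × ℝ => h p.1 p.2) :
    ContDiff ℝ (n + 1) fun p : ℝ × ℝ => diagDoublePrimitive h p.1 p.2 := by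
  refine contDiff_succ_iff_hasFDerivAt.2
    ⟨_, ?_, hasFDerivAt_diagDoublePrimitive hh.continuous⟩
  have hswap : ContDiff ℝ n fun p : ℝ × ℝ => h p.2 p.1 :=
    hh.comp (contDiff_snd.prodMk contDiff_fst)
  exact ((contDiff_diagPrimitive hh).smul contDiff_const).add
    (((contDiff_diagPrimitive (h := fun t s => h s t) hswap).comp
      (contDiff_snd.prodMk contDiff_fst)).smul contDiff_const)

theorem abs_diagPrimitive_sub_le {h₁ h₂ : ℝ → ℝ → ℝ}
    (hh₁ : Continuous fun p : ℝ × ℝ => h₁ p.1 p.2) (hh₂ : Continuous fun p : ℝ × ℝ => h₂ p.1 p.2)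
    {x y C : ℝ} {k : ℕ} (hb : ∀ t ∈ uIcc x y, |h₁ x t - h₂ x t| ≤ C * |t - x| ^ k) :
    |diagPrimitive h₁ x y - diagPrimitive h₂ x y| ≤ C * |y - x| ^ (k + 1) / (k + 1) := by
  rw [diagPrimitive, diagPrimitive, ← intervalIntegral.integral_sub
    ((hh₁.slice x).intervalIntegrable _ _) ((hh₂.slice x).intervalIntegrable _ _),
    ← Real.norm_eq_abs]
  refine (intervalIntegral.norm_integral_le_integral_norm_uIoc).trans ?_
  rw [mul_div_assoc, ← integral_pow_abs_sub_uIoc, ← integral_const_mul]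
  have c₁ := hh₁.slice x
  have c₂ := hh₂.slice x
  refine setIntegral_mono_on ?_ ?_ measurableSet_uIoc fun t ht => hb t (uIoc_subset_uIcc ht)
  · exact (Continuous.integrableOn_uIcc (by fun_prop)).mono_set uIoc_subset_uIcc
  · exact (Continuous.integrableOn_uIcc (by fun_prop)).mono_set uIoc_subset_uIcc

theorem abs_diagDoublePrimitive_sub_le {h₁ h₂ : ℝ → ℝ → ℝ}
    (hh₁ : Continuous fun p : ℝ × ℝ => h₁ p.1 p.2) (hh₂ : Continuous fun p : ℝ × ℝ => h₂ p.1 p.2)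
    {I : Set ℝ} [I.OrdConnected] {C : ℝ} {k : ℕ}
    (hb : ∀ s ∈ I, ∀ t ∈ I, |h₁ s t - h₂ s t| ≤ C * |t - s| ^ k) {x y : ℝ} (hx : x ∈ I)
    (hy : y ∈ I) :
    |diagDoublePrimitive h₁ x y - diagDoublePrimitive h₂ x y| ≤
      C * |y - x| ^ (k + 2) / ((k + 1) * (k + 2)) := by
  have inner : ∀ t ∈ uIcc x y, |diagPrimitive (fun t s => h₁ s t) t x -
      diagPrimitive (fun t s => h₂ s t) t x| ≤ C / (k + 1) * |t - x| ^ (k + 1) := by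
    intro t ht
    have htI : t ∈ I := OrdConnected.uIcc_subset ‹_› hx hy ht
    refine (abs_diagPrimitive_sub_le hh₁.swap_args hh₂.swap_args (C := C) (k := k)
      fun s hs => ?_).trans_eq ?_
    · rw [abs_sub_comm s t]
      exact hb s (OrdConnected.uIcc_subset ‹_› htI hx hs) t htI
    · rw [abs_sub_comm x t]; ring
  refine (abs_diagPrimitive_sub_le (h₁ := fun x t => diagPrimitive (fun t s => h₁ s t) t x)
    (h₂ := fun x t => diagPrimitive (fun t s => h₂ s t) t x)
    (continuous_diagPrimitive hh₁.swap_args).swap_args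
    (continuous_diagPrimitive hh₂.swap_args).swap_args inner).trans_eq ?_
  push_cast
  field_simp
  ring

/-- The Picard operator of the Cauchy problem `∂²u/∂x∂y = G(x,y,u)` with data on the diagonal,
where `u₀` solves the homogeneous equation with the same data. -/
noncomputable def picardStep (u₀ : ℝ → ℝ → ℝ) (G : ℝ → ℝ → ℝ → ℝ) (w : ℝ → ℝ → ℝ) (x y : ℝ) : ℝ :=
  u₀ x y + diagDoublePrimitive (fun s t => G s t (w s t)) x y

section Picard

variable {u₀ : ℝ → ℝ → ℝ} {G : ℝ → ℝ → ℝ → ℝ}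

theorem Continuous.comp_graph (hG : Continuous fun p : ℝ × ℝ × ℝ => G p.1 p.2.1 p.2.2)
    {w : ℝ → ℝ → ℝ} (hw : Continuous fun p : ℝ × ℝ => w p.1 p.2) :
    Continuous fun p : ℝ × ℝ => G p.1 p.2 (w p.1 p.2) :=
  hG.comp (continuous_fst.prodMk (continuous_snd.prodMk hw))

theorem continuous_picardStep (hu₀ : Continuous fun p : ℝ × ℝ => u₀ p.1 p.2)
    (hG : Continuous fun p : ℝ × ℝ × ℝ => G p.1 p.2.1 p.2.2)
    {w : ℝ → ℝ → ℝ} (hw : Continuous fun p : ℝ × ℝ => w p.1 p.2) :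
    Continuous fun p : ℝ × ℝ => picardStep u₀ G w p.1 p.2 :=
  hu₀.add (continuous_diagDoublePrimitive (hG.comp_graph hw))

theorem abs_picardStep_sub_le (hG : Continuous fun p : ℝ × ℝ × ℝ => G p.1 p.2.1 p.2.2)
    {I : Set ℝ} [I.OrdConnected] {M : ℝ} (hM : 0 ≤ M)
    (hLip : ∀ s ∈ I, ∀ t ∈ I, ∀ a b, |G s t a - G s t b| ≤ M * |a - b|)
    {u v : ℝ → ℝ → ℝ} (hu : Continuous fun p : ℝ × ℝ => u p.1 p.2)
    (hv : Continuous fun p : ℝ × ℝ => v p.1 p.2) {C : ℝ} {k : ℕ}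
    (hb : ∀ s ∈ I, ∀ t ∈ I, |u s t - v s t| ≤ C * |t - s| ^ k) {x y : ℝ} (hx : x ∈ I)
    (hy : y ∈ I) :
    |picardStep u₀ G u x y - picardStep u₀ G v x y| ≤
      M * C * |y - x| ^ (k + 2) / ((k + 1) * (k + 2)) := by
  rw [picardStep, picardStep, add_sub_add_left_eq_sub]
  refine abs_diagDoublePrimitive_sub_le (hG.comp_graph hu) (hG.comp_graph hv)
    (fun s hs t ht => ?_) hx hy
  rw [mul_assoc]
  exact (hLip s hs t ht _ _).trans (mul_le_mul_of_nonneg_left (hb s hs t ht) hM)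

theorem abs_sub_le_of_picardStep (hG : Continuous fun p : ℝ × ℝ × ℝ => G p.1 p.2.1 p.2.2)
    {R M C : ℝ} (hM : 0 ≤ M)
    (hLip : ∀ s ∈ Icc (-R) R, ∀ t ∈ Icc (-R) R, ∀ a b, |G s t a - G s t b| ≤ M * |a - b|)
    {u v : ℕ → ℝ → ℝ → ℝ} (hu : ∀ n, Continuous fun p : ℝ × ℝ => u n p.1 p.2)
    (hv : ∀ n, Continuous fun p : ℝ × ℝ => v n p.1 p.2)
    (hus : ∀ n, u (n + 1) = picardStep u₀ G (u n)) (hvs : ∀ n, v (n + 1) = picardStep u₀ G (v n))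
    (hb : ∀ s ∈ Icc (-R) R, ∀ t ∈ Icc (-R) R, |u 0 s t - v 0 s t| ≤ C)
    {x y : ℝ} (hx : x ∈ Icc (-R) R) (hy : y ∈ Icc (-R) R) (n : ℕ) :
    |u n x y - v n x y| ≤ C * ((M * (2 * R) ^ 2) ^ n / n.factorial) := by
  have hC : 0 ≤ C := (abs_nonneg _).trans (hb x hx y hy)
  have key : ∀ n : ℕ, ∀ x ∈ Icc (-R) R, ∀ y ∈ Icc (-R) R,
      |u n x y - v n x y| ≤ C * M ^ n / (2 * n).factorial * |y - x| ^ (2 * n) := by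
    intro n
    induction n with
    | zero => simpa using hb
    | succ n ih =>
      intro x hx y hy
      rw [hus, hvs]
      refine (abs_picardStep_sub_le hG hM hLip (hu n) (hv n) ih hx hy).trans_eq ?_
      rw [show 2 * (n + 1) = 2 * n + 1 + 1 by ring, Nat.factorial_succ, Nat.factorial_succ]
      have := Nat.cast_ne_zero (R := ℝ).2 (Nat.factorial_ne_zero (2 * n))
      push_cast
      field_simp
      ring
  refine (key n x hx y hy).trans ?_
  have h1 : |y - x| ≤ 2 * R := abs_le.2 ⟨by linarith [hx.2, hy.1], by linarith [hx.1, hy.2]⟩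
  have h2 : ((n.factorial : ℕ) : ℝ) ≤ (2 * n).factorial := by
    exact_mod_cast Nat.factorial_le (by omega)
  have h3 : (0 : ℝ) < n.factorial := by exact_mod_cast n.factorial_pos
  calc C * M ^ n / (2 * n).factorial * |y - x| ^ (2 * n)
      ≤ C * M ^ n / n.factorial * (2 * R) ^ (2 * n) := by gcongr
    _ = C * ((M * (2 * R) ^ 2) ^ n / n.factorial) := by rw [mul_pow M, ← pow_mul]; ring

theorem exists_abs_sub_le_of_continuous {u v : ℝ → ℝ → ℝ}
    (hu : Continuous fun p : ℝ × ℝ => u p.1 p.2) (hv : Continuous fun p : ℝ × ℝ => v p.1 p.2)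
    (R : ℝ) : ∃ C, ∀ s ∈ Icc (-R) R, ∀ t ∈ Icc (-R) R, |u s t - v s t| ≤ C := by
  obtain ⟨C, hC⟩ := ((isCompact_Icc (a := -R) (b := R)).prod (isCompact_Icc (a := -R) (b := R))
    ).exists_bound_of_continuousOn (hu.sub hv).continuousOn
  exact ⟨C, fun s hs t ht => hC (s, t) ⟨hs, ht⟩⟩

theorem exists_mem_Ioo_neg (x y : ℝ) : ∃ R : ℝ, x ∈ Ioo (-R) R ∧ y ∈ Ioo (-R) R :=
  ⟨|x| + |y| + 1, abs_lt.1 (by linarith [abs_nonneg y]), abs_lt.1 (by linarith [abs_nonneg x])⟩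

theorem eq_of_eq_picardStep (hG : Continuous fun p : ℝ × ℝ × ℝ => G p.1 p.2.1 p.2.2)
    (hLip : ∀ R : ℝ, ∃ M, 0 ≤ M ∧
      ∀ s ∈ Icc (-R) R, ∀ t ∈ Icc (-R) R, ∀ a b, |G s t a - G s t b| ≤ M * |a - b|)
    {u v : ℝ → ℝ → ℝ} (hu : Continuous fun p : ℝ × ℝ => u p.1 p.2)
    (hv : Continuous fun p : ℝ × ℝ => v p.1 p.2)
    (hus : u = picardStep u₀ G u) (hvs : v = picardStep u₀ G v) : u = v := by
  funext x y
  obtain ⟨R, hx, hy⟩ := exists_mem_Ioo_neg x y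
  obtain ⟨M, hM, hL⟩ := hLip R
  obtain ⟨C, hC⟩ := exists_abs_sub_le_of_continuous hu hv R
  have hlim : Tendsto (fun n : ℕ => C * ((M * (2 * R) ^ 2) ^ n / n.factorial)) atTop (𝓝 0) := by
    simpa using (FloorSemiring.tendsto_pow_div_factorial_atTop (M * (2 * R) ^ 2)).const_mul C
  have := ge_of_tendsto' hlim fun n => abs_sub_le_of_picardStep (u := fun _ => u) (v := fun _ => v)
    hG hM hL (fun _ => hu) (fun _ => hv) (fun _ => hus) (fun _ => hvs) hC
    (Ioo_subset_Icc_self hx) (Ioo_subset_Icc_self hy) n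
  exact sub_eq_zero.1 (abs_nonpos_iff.1 this)

theorem exists_eq_picardStep (hu₀ : Continuous fun p : ℝ × ℝ => u₀ p.1 p.2)
    (hG : Continuous fun p : ℝ × ℝ × ℝ => G p.1 p.2.1 p.2.2)
    (hLip : ∀ R : ℝ, ∃ M, 0 ≤ M ∧
      ∀ s ∈ Icc (-R) R, ∀ t ∈ Icc (-R) R, ∀ a b, |G s t a - G s t b| ≤ M * |a - b|) :
    ∃ w : ℝ → ℝ → ℝ, (Continuous fun p : ℝ × ℝ => w p.1 p.2) ∧ w = picardStep u₀ G w := by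
  set W : ℕ → ℝ → ℝ → ℝ := fun n => (picardStep u₀ G)^[n] u₀ with hW
  have hWs : ∀ n, W (n + 1) = picardStep u₀ G (W n) := fun n =>
    Function.iterate_succ_apply' _ _ _
  have hWc : ∀ n, Continuous fun p : ℝ × ℝ => W n p.1 p.2 := by
    intro n
    induction n with
    | zero => exact hu₀
    | succ n ih => rw [hWs]; exact continuous_picardStep hu₀ hG ih
  have hbound : ∀ R : ℝ, ∃ d : ℕ → ℝ, Summable d ∧ ∀ x ∈ Icc (-R) R, ∀ y ∈ Icc (-R) R, ∀ n,
      dist (W n x y) (W n.succ x y) ≤ d n := by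
    intro R
    obtain ⟨M, hM, hL⟩ := hLip R
    obtain ⟨C, hC⟩ := exists_abs_sub_le_of_continuous (hWc 0) (hWc 1) R
    refine ⟨_, (Real.summable_pow_div_factorial (M * (2 * R) ^ 2)).mul_left C,
      fun x hx y hy n => ?_⟩
    rw [Real.dist_eq]
    exact abs_sub_le_of_picardStep (v := fun n => W (n + 1)) hG hM hL hWc (fun n => hWc _) hWs
      (fun n => hWs _) hC hx hy n
  have hlim : ∀ x y, ∃ l, Tendsto (fun n => W n x y) atTop (𝓝 l) := by
    intro x y
    obtain ⟨R, hx, hy⟩ := exists_mem_Ioo_neg x y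
    obtain ⟨d, hd, hdb⟩ := hbound R
    exact cauchySeq_tendsto_of_complete (cauchySeq_of_dist_le_of_summable d
      (hdb x (Ioo_subset_Icc_self hx) y (Ioo_subset_Icc_self hy)) hd)
  choose w hw using hlim
  have hunif : ∀ R : ℝ, ∃ e : ℕ → ℝ, Tendsto e atTop (𝓝 0) ∧
      ∀ x ∈ Icc (-R) R, ∀ y ∈ Icc (-R) R, ∀ n, |W n x y - w x y| ≤ e n := by
    intro R
    obtain ⟨d, hd, hdb⟩ := hbound R
    refine ⟨fun n => ∑' m, d (n + m), ?_, fun x hx y hy n => ?_⟩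
    · simpa only [add_comm] using tendsto_sum_nat_add d
    · rw [← Real.dist_eq]
      exact dist_le_tsum_of_dist_le_of_tendsto d (hdb x hx y hy) hd (hw x y) n
  have hwc : Continuous fun p : ℝ × ℝ => w p.1 p.2 := by
    refine continuous_iff_continuousAt.2 fun p => ?_
    obtain ⟨R, hx, hy⟩ := exists_mem_Ioo_neg p.1 p.2
    obtain ⟨e, he, heb⟩ := hunif R
    have hU : TendstoUniformlyOn (fun n (p : ℝ × ℝ) => W n p.1 p.2) (fun p => w p.1 p.2) atTop
        (Icc (-R) R ×ˢ Icc (-R) R) := by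
      refine Metric.tendstoUniformlyOn_iff.2 fun ε hε => ?_
      filter_upwards [he.eventually_lt_const hε] with n hn q hq
      rw [dist_comm, Real.dist_eq]
      exact (heb q.1 hq.1 q.2 hq.2 n).trans_lt hn
    exact (hU.continuousOn (Frequently.of_forall fun n => (hWc n).continuousOn)).continuousAt
      (prod_mem_nhds (Icc_mem_nhds hx.1 hx.2) (Icc_mem_nhds hy.1 hy.2))
  refine ⟨w, hwc, ?_⟩
  funext x y
  obtain ⟨R, hx, hy⟩ := exists_mem_Ioo_neg x y
  obtain ⟨M, hM, hL⟩ := hLip R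
  obtain ⟨e, he, heb⟩ := hunif R
  refine tendsto_nhds_unique ((hw x y).comp (tendsto_add_atTop_nat 1)) ?_
  have hz : Tendsto (fun n => M * e n * |y - x| ^ (0 + 2) / (((0 : ℕ) + 1) * ((0 : ℕ) + 2)))
      atTop (𝓝 0) := by
    simpa only [mul_zero, zero_mul, zero_div] using ((he.const_mul M).mul_const (|y - x| ^ (0 + 2))).div_const
      ((((0 : ℕ) : ℝ) + 1) * ((0 : ℕ) + 2))
  refine tendsto_iff_dist_tendsto_zero.2 (squeeze_zero (fun _ => dist_nonneg) (fun n => ?_) hz)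
  rw [Function.comp_apply, hWs, Real.dist_eq]
  exact abs_picardStep_sub_le hG hM hL (hWc n) hwc
    (fun s hs t ht => by simpa using heb s hs t ht n)
    (Ioo_subset_Icc_self hx) (Ioo_subset_Icc_self hy)

theorem contDiff_of_eq_picardStep (hu₀ : ContDiff ℝ (⊤ : ℕ∞) fun p : ℝ × ℝ => u₀ p.1 p.2)
    (hG : ContDiff ℝ (⊤ : ℕ∞) fun p : ℝ × ℝ × ℝ => G p.1 p.2.1 p.2.2) {w : ℝ → ℝ → ℝ}
    (hw : Continuous fun p : ℝ × ℝ => w p.1 p.2) (hws : w = picardStep u₀ G w) :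
    ContDiff ℝ (⊤ : ℕ∞) fun p : ℝ × ℝ => w p.1 p.2 := by
  refine contDiff_infty.2 fun n => ?_
  induction n with
  | zero => exact contDiff_zero.2 hw
  | succ n ih =>
    rw [hws]
    have hgraph : ContDiff ℝ n fun p : ℝ × ℝ => G p.1 p.2 (w p.1 p.2) :=
      (contDiff_infty.1 hG n).comp (contDiff_fst.prodMk (contDiff_snd.prodMk ih))
    rw [Nat.cast_succ]
    exact (contDiff_infty.1 hu₀ (n + 1)).add
      (contDiff_succ_diagDoublePrimitive (h := fun s t => G s t (w s t)) hgraph)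

end Picard

/-- The Cauchy problem with data on the diagonal. -/
theorem existsUnique_smooth_solution_diag {φ χ : ℝ → ℝ} {G : ℝ → ℝ → ℝ → ℝ}
    (hφ : ContDiff ℝ (⊤ : ℕ∞) φ) (hχ : ContDiff ℝ (⊤ : ℕ∞) χ)
    (hG : ContDiff ℝ (⊤ : ℕ∞) fun p : ℝ × ℝ × ℝ => G p.1 p.2.1 p.2.2)
    (hLip : ∀ R : ℝ, ∃ M, 0 ≤ M ∧
      ∀ s ∈ Icc (-R) R, ∀ t ∈ Icc (-R) R, ∀ a b, |G s t a - G s t b| ≤ M * |a - b|) :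
    ∃! u : ℝ → ℝ → ℝ,
      ContDiff ℝ (⊤ : ℕ∞) (fun p : ℝ × ℝ => u p.1 p.2) ∧
      (∀ x y, deriv (fun x' => deriv (fun y' => u x' y') y) x = G x y (u x y)) ∧
      (∀ x, u x x = φ x) ∧
      (∀ x, deriv (fun y' => u x y') x = χ x) := by
  set u₀ : ℝ → ℝ → ℝ := fun x y => φ x + diagPrimitive (fun _ t => χ t) x y with hu₀
  have hχ₂ : ContDiff ℝ (⊤ : ℕ∞) fun p : ℝ × ℝ => χ p.2 := hχ.comp contDiff_snd
  have su₀ : ContDiff ℝ (⊤ : ℕ∞) fun p : ℝ × ℝ => u₀ p.1 p.2 :=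
    (hφ.comp contDiff_fst).add
      (contDiff_infty.2 fun n => contDiff_diagPrimitive (h := fun _ t => χ t)
        (contDiff_infty.1 hχ₂ n))
  have hstep : ∀ w : ℝ → ℝ → ℝ, (Continuous fun p : ℝ × ℝ => w p.1 p.2) → ∀ x y,
      HasDerivAt (fun y' => picardStep u₀ G w x y')
        (χ y + diagPrimitive (fun t s => G s t (w s t)) y x) y := fun w hw x y =>
    ((hasDerivAt_diagPrimitive (h := fun _ t => χ t) hχ₂.continuous x y).const_add (φ x)).add
      (hasDerivAt_diagDoublePrimitive (hG.continuous.comp_graph hw) x y)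
  have hself : ∀ w x, picardStep u₀ G w x x = φ x := fun w x => by
    simp [picardStep, hu₀, diagDoublePrimitive, diagPrimitive_self]
  obtain ⟨w, hwc, hw⟩ := exists_eq_picardStep su₀.continuous hG.continuous hLip
  have hwy : ∀ x y, deriv (fun y' => w x y') y =
      χ y + diagPrimitive (fun t s => G s t (w s t)) y x := fun x y => by
    conv_lhs => rw [hw]
    exact (hstep w hwc x y).deriv
  refine ⟨w, ⟨contDiff_of_eq_picardStep su₀ hG hwc hw, fun x y => ?_, fun x => ?_, fun x => ?_⟩,
    fun v ⟨sv, hvxy, hvφ, hvχ⟩ => ?_⟩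
  · simp only [hwy]
    exact ((hasDerivAt_diagPrimitive (h := fun t s => G s t (w s t))
      ((hG.continuous.comp_graph hwc).comp continuous_swap) y x).const_add (χ y)).deriv
  · rw [hw, hself]
  · rw [hwy, diagPrimitive_self, add_zero]
  · refine eq_of_eq_picardStep hG.continuous hLip sv.continuous hwc ?_ hw
    set V : ℝ × ℝ → ℝ := fun p => v p.1 p.2
    have hvy : ∀ x y, HasDerivAt (fun y' => v x y') (fderiv ℝ V (x, y) (0, 1)) y := fun x y =>
      HasFDerivAt.comp_hasDerivAt (l := V) y ((sv.differentiable (by simp)) (x, y)).hasFDerivAt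
        ((hasDerivAt_const y x).prodMk (hasDerivAt_id' y))
    have sD : ContDiff ℝ (⊤ : ℕ∞) fun p : ℝ × ℝ => fderiv ℝ V p (0, 1) :=
      (sv.fderiv_right (by simp)).clm_apply contDiff_const
    have hvy' : ∀ x y, deriv (fun y' => v x y') y =
        χ y + diagPrimitive (fun t s => G s t (v s t)) y x := by
      intro x y
      have hdiff : Differentiable ℝ fun x' => deriv (fun y' => v x' y') y := by
        simp only [fun x' => (hvy x' y).deriv]
        exact (sD.comp (contDiff_id.prodMk contDiff_const)).differentiable (by simp)
      have hFTC := intervalIntegral.integral_eq_sub_of_hasDerivAt (a := y) (b := x)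
        (f := fun x' => deriv (fun y' => v x' y') y) (f' := fun s => G s y (v s y))
        (fun s _ => hvxy s y ▸ (hdiff s).hasDerivAt)
        (((hG.continuous.comp_graph sv.continuous).comp
          (Continuous.prodMk_left y)).intervalIntegrable _ _)
      rw [hvχ] at hFTC
      rw [diagPrimitive, hFTC]
      ring
    funext x y
    have hd : ∀ t, HasDerivAt (fun y' => v x y' - picardStep u₀ G v x y') 0 t := fun t => by
      have h := (hvy x t).differentiableAt.hasDerivAt.sub (hstep v sv.continuous x t)
      rwa [hvy', sub_self] at h
    have := is_const_of_deriv_eq_zero (fun t => (hd t).differentiableAt) (fun t => (hd t).deriv) y x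
    simp only [hvφ, hself, sub_self] at this
    linarith

/-- In the non-characteristic case (data on the curve `y = f(x)` with `f` a smooth strictly
increasing bijection with nowhere-vanishing derivative), the Cauchy problem
`∂²u/∂x∂y = F(x,y,u)`, `u(x,f(x)) = φ(x)`, `∂u/∂y(x,f(x)) = ψ(x)` has exactly one smooth
solution. -/
theorem existsUnique_smooth_solution (f φ ψ : ℝ → ℝ) (F : ℝ → ℝ → ℝ → ℝ)
    (hf : ContDiff ℝ (⊤ : ℕ∞) f) (hmono : StrictMono f) (hbij : Function.Bijective f)
    (hf' : ∀ x, deriv f x ≠ 0)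
    (hφ : ContDiff ℝ (⊤ : ℕ∞) φ) (hψ : ContDiff ℝ (⊤ : ℕ∞) ψ)
    (hF : ContDiff ℝ (⊤ : ℕ∞) (fun p : ℝ × ℝ × ℝ => F p.1 p.2.1 p.2.2))
    (hH : ∀ K : Set (ℝ × ℝ), IsCompact K →
      ∃ M : ℝ, ∀ p ∈ K, ∀ z : ℝ, |deriv (fun w => F p.1 p.2 w) z| ≤ M) :
    ∃! u : ℝ → ℝ → ℝ,
      ContDiff ℝ (⊤ : ℕ∞) (fun p : ℝ × ℝ => u p.1 p.2) ∧
      (∀ x y, deriv (fun x' => deriv (fun y' => u x' y') y) x = F x y (u x y)) ∧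
      (∀ x, u x (f x) = φ x) ∧
      (∀ x, deriv (fun y' => u x y') (f x) = ψ x) := by
  have hfd : ∀ x, HasDerivAt f (deriv f x) x := fun x =>
    (hf.differentiable (by simp) x).hasDerivAt
  have sf' : ContDiff ℝ (⊤ : ℕ∞) (deriv f) := (contDiff_infty_iff_deriv.1 hf).2
  set e : ℝ ≃ₜ ℝ := (hmono.orderIsoOfSurjective f hbij.surjective).toHomeomorph
  set g : ℝ → ℝ := fun y => e.symm y
  have hfg : ∀ y, f (g y) = y := fun y => e.apply_symm_apply y
  have hgf : ∀ x, g (f x) = x := fun x => e.symm_apply_apply x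
  have sg : ContDiff ℝ (⊤ : ℕ∞) g := e.contDiff_symm_deriv hf' hfd hf
  have hgd : ∀ y, HasDerivAt g (deriv f (g y))⁻¹ y := fun y =>
    HasDerivAt.of_local_left_inverse sg.continuous.continuousAt (hfd _) (hf' _)
      (Eventually.of_forall hfg)
  set G : ℝ → ℝ → ℝ → ℝ := fun x y z => deriv f y * F x (f y) z with hGdef
  have sG : ContDiff ℝ (⊤ : ℕ∞) fun p : ℝ × ℝ × ℝ => G p.1 p.2.1 p.2.2 :=
    (sf'.comp (contDiff_fst.comp contDiff_snd)).mul (hF.comp (contDiff_fst.prodMk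
      ((hf.comp (contDiff_fst.comp contDiff_snd)).prodMk (contDiff_snd.comp contDiff_snd))))
  have hLip : ∀ R : ℝ, ∃ M, 0 ≤ M ∧
      ∀ s ∈ Icc (-R) R, ∀ t ∈ Icc (-R) R, ∀ a b, |G s t a - G s t b| ≤ M * |a - b| := by
    intro R
    obtain ⟨M, hM⟩ := hH (Icc (-R) R ×ˢ (f '' Icc (-R) R))
      (isCompact_Icc.prod (isCompact_Icc.image hf.continuous))
    obtain ⟨D, hD⟩ := (isCompact_Icc (a := -R) (b := R)).exists_bound_of_continuousOn
      sf'.continuous.continuousOn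
    refine ⟨|D| * |M|, by positivity, fun s hs t ht a b => ?_⟩
    have hFd : Differentiable ℝ fun z => F s (f t) z :=
      (hF.comp (contDiff_const.prodMk (contDiff_const.prodMk contDiff_id))).differentiable (by simp)
    have hFL : |F s (f t) a - F s (f t) b| ≤ |M| * |a - b| :=
      convex_univ.norm_image_sub_le_of_norm_deriv_le (fun z _ => hFd z)
        (fun z _ => (hM (s, f t) ⟨hs, mem_image_of_mem f ht⟩ z).trans (le_abs_self M))
        (mem_univ b) (mem_univ a)
    rw [hGdef, ← mul_sub, abs_mul, mul_assoc]
    exact mul_le_mul ((hD t ht).trans (le_abs_self D)) hFL (abs_nonneg _) (abs_nonneg _)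
  have hslice : ∀ {v : ℝ → ℝ → ℝ}, ContDiff ℝ (⊤ : ℕ∞) (fun p : ℝ × ℝ => v p.1 p.2) → ∀ x y,
      HasDerivAt (v x) (deriv (fun y' => v x y') y) y := fun {v} sv x y =>
    ((sv.comp (contDiff_const.prodMk contDiff_id)).differentiable (by simp) y).hasDerivAt
  obtain ⟨v, ⟨sv, hvxy, hvφ, hvχ⟩, huniq⟩ :=
    existsUnique_smooth_solution_diag hφ (sf'.mul hψ) sG hLip
  have huy : ∀ x y, deriv (fun y' => v x (g y')) y =
      deriv (fun y' => v x y') (g y) * (deriv f (g y))⁻¹ := fun x y =>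
    ((hslice sv x (g y)).comp y (hgd y)).deriv
  refine ⟨fun x y => v x (g y), ⟨?_, fun x y => ?_, fun x => ?_, fun x => ?_⟩,
    fun u ⟨su, huxy, huφ, huψ⟩ => ?_⟩
  · exact sv.comp (contDiff_fst.prodMk (sg.comp contDiff_snd))
  · simp only [huy, deriv_mul_const_field, hvxy, hGdef, hfg]
    field_simp [hf' (g y)]
  · simp only [hgf, hvφ]
  · rw [huy, hgf, hvχ]
    field_simp [hf' x]
  · have hvy : ∀ x y, deriv (fun y' => u x (f y')) y =
        deriv (fun y' => u x y') (f y) * deriv f y := fun x y =>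
      ((hslice su x (f y)).comp y (hfd y)).deriv
    have hv := huniq (fun x y => u x (f y))
      ⟨su.comp (contDiff_fst.prodMk (hf.comp contDiff_snd)), fun x y => by
        simp only [hvy, deriv_mul_const_field, huxy, hGdef, mul_comm (deriv f y)], huφ, fun x => by
        rw [hvy, huψ, mul_comm]⟩
    funext x y
    rw [← hv]
    simp only [hfg]
end

section
/- There exist families (f_ε)_{ε∈(0,1]} and (g_ε)_{ε∈(0,1]} of smooth strictly increasing bijections of ℝ, with f_ε(x) = εx, such that: (i) for every compact K⊂ℝ there exists ε₀∈(0,1] with f_ε = g_ε on K for all ε ≤ ε₀ (so (f_ε − g_ε) is locally negligible); (ii) the families (f_ε), (g_ε), (f_ε⁻¹), (g_ε⁻¹) are tempered moderate; (iii) sup_{y∈[3,4]} |f_ε⁻¹(y) − g_ε⁻¹(y)| = 1/ε for every ε∈(0,1]; in particular (f_ε⁻¹ − g_ε⁻¹) is not locally negligible and (f_ε − g_ε) is not tempered negligible. -/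
/-- Tempered moderate family of smooth functions `ℝ → ℝ`, indexed by `ε ∈ (0,1]`. -/
def TempModerate (f : ℝ → ℝ → ℝ) : Prop :=
  ∀ m : ℕ, ∃ q N : ℕ, ∃ C : ℝ, 0 < C ∧ ∃ ε₀ ∈ Set.Ioc (0:ℝ) 1,
    ∀ ε ∈ Set.Ioc (0:ℝ) 1, ε ≤ ε₀ →
      ∀ x : ℝ, ∀ k ≤ m, |iteratedDeriv k (f ε) x| ≤ C * (1 + |x|) ^ q / ε ^ N

/-- Tempered negligible family of smooth functions `ℝ → ℝ`, indexed by `ε ∈ (0,1]`. -/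
def TempNegligible (f : ℝ → ℝ → ℝ) : Prop :=
  ∀ m : ℕ, ∃ q : ℕ, ∀ p : ℕ, ∃ C : ℝ, 0 < C ∧ ∃ ε₀ ∈ Set.Ioc (0:ℝ) 1,
    ∀ ε ∈ Set.Ioc (0:ℝ) 1, ε ≤ ε₀ →
      ∀ x : ℝ, ∀ k ≤ m, |iteratedDeriv k (f ε) x| ≤ C * (1 + |x|) ^ q * ε ^ p

/-- Locally negligible family of smooth functions `ℝ → ℝ`, indexed by `ε ∈ (0,1]`. -/
def LocNegligible1 (f : ℝ → ℝ → ℝ) : Prop :=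
  ∀ K : Set ℝ, IsCompact K → ∀ l : ℕ, ∀ p : ℕ, ∃ C : ℝ, 0 < C ∧
    ∃ ε₀ ∈ Set.Ioc (0:ℝ) 1, ∀ ε ∈ Set.Ioc (0:ℝ) 1, ε ≤ ε₀ →
      ∀ x ∈ K, ∀ k ≤ l, |iteratedDeriv k (f ε) x| ≤ C * ε ^ p

open Set Filter Topology

/-- Every derivative of `F` (including `F` itself) grows at most linearly. -/
def DerivsLinearGrowth (F : ℝ → ℝ) : Prop :=
  ∀ m : ℕ, ∃ C : ℝ, 0 < C ∧ ∀ x : ℝ, ∀ k ≤ m, |iteratedDeriv k F x| ≤ C * (1 + |x|)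

theorem abs_iteratedDeriv_add_const_le (a x : ℝ) (k : ℕ) :
    |iteratedDeriv k (fun z : ℝ => z + a) x| ≤ (1 + |a|) * (1 + |x|) := by
  have h := congrFun (iteratedDeriv_comp_add_const k (id : ℝ → ℝ) a) x
  simp only [id] at h
  rw [h]
  change |iteratedDeriv k id (x + a)| ≤ _
  rw [iteratedDeriv_id]
  have h₁ := abs_add_le x a
  have h₂ : 0 ≤ |a| * |x| := by positivity
  have h₃ := abs_nonneg a
  have h₄ := abs_nonneg x
  split_ifs
  · nlinarith
  · rw [abs_one]; nlinarith
  · rw [abs_zero]; positivity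

/-- A smooth function that is a translation near `-∞` and near `+∞` has derivatives of linear
growth. -/
theorem derivsLinearGrowth_of_eq_translation {F : ℝ → ℝ} (hF : ContDiff ℝ (⊤ : ℕ∞) F)
    {a b A B : ℝ} (hA : ∀ x ≤ A, F x = x + a) (hB : ∀ x, B ≤ x → F x = x + b) :
    DerivsLinearGrowth F := by
  have key : ∀ k : ℕ, ∃ C : ℝ, 0 < C ∧ ∀ x : ℝ, |iteratedDeriv k F x| ≤ C * (1 + |x|) := by
    intro k
    obtain ⟨M, hM⟩ := (isCompact_Icc (a := A) (b := B)).exists_bound_of_continuousOn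
      (hF.continuous_iteratedDeriv k (by exact_mod_cast le_top)).continuousOn
    refine ⟨1 + |a| + |b| + |M|, by positivity, fun x => ?_⟩
    have hx := abs_nonneg x
    have ha := abs_nonneg a
    have hb := abs_nonneg b
    have hM0 := abs_nonneg M
    rcases lt_or_ge x A with hxA | hxA
    · have he : F =ᶠ[𝓝 x] fun z => z + a := by
        filter_upwards [Iio_mem_nhds hxA] with z hz using hA z (le_of_lt hz)
      rw [he.iteratedDeriv_eq k]
      exact (abs_iteratedDeriv_add_const_le a x k).trans (mul_le_mul_of_nonneg_right (by linarith) (by positivity))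
    rcases lt_or_ge B x with hxB | hxB
    · have he : F =ᶠ[𝓝 x] fun z => z + b := by
        filter_upwards [Ioi_mem_nhds hxB] with z hz using hB z (le_of_lt hz)
      rw [he.iteratedDeriv_eq k]
      exact (abs_iteratedDeriv_add_const_le b x k).trans (mul_le_mul_of_nonneg_right (by linarith) (by positivity))
    · have h := hM x ⟨hxA, hxB⟩
      rw [Real.norm_eq_abs] at h
      have h' := le_abs_self M
      nlinarith [mul_nonneg ha hx, mul_nonneg hb hx, mul_nonneg hM0 hx]
  choose C hC hCF using key
  intro m
  refine ⟨∑ k ∈ Finset.range (m + 1), C k,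
    Finset.sum_pos (fun k _ => hC k) ⟨0, by simp⟩, fun x k hk => (hCF k x).trans ?_⟩
  gcongr
  exact Finset.single_le_sum (f := C) (fun i _ => (hC i).le) (by simp; omega)

theorem derivsLinearGrowth_id : DerivsLinearGrowth fun x => x :=
  derivsLinearGrowth_of_eq_translation (a := 0) (b := 0) (A := 0) (B := 0) contDiff_id
    (by simp) (by simp)

theorem DerivsLinearGrowth.tempModerate_comp_mul {F : ℝ → ℝ} (hF : DerivsLinearGrowth F)
    (hs : ContDiff ℝ (⊤ : ℕ∞) F) : TempModerate fun ε x => F (ε * x) := by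
  intro m
  obtain ⟨C, hC, h⟩ := hF m
  refine ⟨1, 0, C, hC, 1, by simp, fun ε hε _ x k hk => ?_⟩
  rw [iteratedDeriv_comp_const_mul (hs.of_le (by exact_mod_cast le_top)) ε, abs_mul, abs_pow,
    abs_of_pos hε.1, pow_one, pow_zero, div_one]
  calc ε ^ k * |iteratedDeriv k F (ε * x)|
      ≤ 1 * (C * (1 + |ε * x|)) := by
        gcongr
        · exact pow_le_one₀ hε.1.le hε.2
        · exact h _ k hk
    _ ≤ C * (1 + |x|) := by
        rw [one_mul, abs_mul, abs_of_pos hε.1]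
        gcongr
        exact mul_le_of_le_one_left (abs_nonneg x) hε.2

theorem DerivsLinearGrowth.tempModerate_div {F : ℝ → ℝ} (hF : DerivsLinearGrowth F)
    {f : ℝ → ℝ → ℝ} (hf : ∀ ε ∈ Ioc (0 : ℝ) 1, f ε = fun x => F x / ε) : TempModerate f := by
  intro m
  obtain ⟨C, hC, h⟩ := hF m
  refine ⟨1, 1, C, hC, 1, by simp, fun ε hε _ x k hk => ?_⟩
  rw [hf ε hε, iteratedDeriv_div_const, abs_div, abs_of_pos hε.1, pow_one, pow_one]
  exact div_le_div_of_nonneg_right (h x k hk) hε.1.le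

/-- A family that vanishes on each bounded interval `(-R, R)` for small `ε` is locally
negligible. -/
theorem locNegligible1_of_eventually_zero {f : ℝ → ℝ → ℝ}
    (hf : ∀ R : ℝ, ∃ ε₀ ∈ Ioc (0 : ℝ) 1, ∀ ε ∈ Ioc (0 : ℝ) 1, ε ≤ ε₀ →
      ∀ x, |x| < R → f ε x = 0) : LocNegligible1 f := by
  intro K hK l p
  obtain ⟨R, hR⟩ := hK.exists_bound_of_continuousOn (f := id) continuousOn_id
  obtain ⟨ε₀, hε₀, h⟩ := hf (R + 1)
  refine ⟨1, one_pos, ε₀, hε₀, fun ε hε hle x hx k _ => ?_⟩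
  have hxR : |x| < R + 1 := by
    have := hR x hx
    rw [id, Real.norm_eq_abs] at this
    linarith
  have he : f ε =ᶠ[𝓝 x] fun _ => 0 := by
    filter_upwards [(isOpen_lt continuous_abs continuous_const).mem_nhds hxR] with z hz
      using h ε hε hle z hz
  rw [he.iteratedDeriv_eq k]
  have := hε.1
  simp only [iteratedDeriv_fun_const_zero, abs_zero]
  positivity

/-- There are mutually inverse smooth increasing functions `G`, `H` on `ℝ` with `G x = x` on
`(-∞, 1]`, `G x = x - 1` on `[3, ∞)`, `H y = y` on `(-∞, 1]` and `H y = y + 1` on `[2, ∞)`. -/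
theorem exists_smooth_shift : ∃ G H : ℝ → ℝ, ContDiff ℝ (⊤ : ℕ∞) G ∧ ContDiff ℝ (⊤ : ℕ∞) H ∧
    StrictMono G ∧ Function.RightInverse H G ∧
    (∀ x ≤ 1, G x = x) ∧ (∀ x, 3 ≤ x → G x = x - 1) ∧
    (∀ y ≤ 1, H y = y) ∧ (∀ y, 2 ≤ y → H y = y + 1) := by
  set s : ℝ → ℝ := fun y => Real.smoothTransition (y - 1) with hs
  set H : ℝ → ℝ := fun y => y + s y with hH
  have hsmooth : ContDiff ℝ (⊤ : ℕ∞) s :=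
    Real.smoothTransition.contDiff.comp (contDiff_id.sub contDiff_const)
  have hHsmooth : ContDiff ℝ (⊤ : ℕ∞) H := contDiff_id.add hsmooth
  have hmono : Monotone s := fun x y hxy => Real.smoothTransition.monotone (by linarith)
  have hHmono : StrictMono H := strictMono_id.add_monotone hmono
  have hle : ∀ y, y ≤ H y := fun y => le_add_of_nonneg_right (Real.smoothTransition.nonneg _)
  have hge : ∀ y, H y ≤ y + 1 := fun y => by
    have := Real.smoothTransition.le_one (y - 1)
    simp only [hH, hs]; linarith
  have hsurj : Function.Surjective H := hHsmooth.continuous.surjective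
    (tendsto_atTop_mono hle tendsto_id)
    (tendsto_atBot_mono hge (tendsto_atBot_add_const_right _ 1 tendsto_id))
  have hH1 : ∀ y ≤ 1, H y = y := fun y hy => by
    simp only [hH, hs]
    rw [Real.smoothTransition.zero_of_nonpos (by linarith), add_zero]
  have hH2 : ∀ y, 2 ≤ y → H y = y + 1 := fun y hy => by
    simp only [hH, hs]
    rw [Real.smoothTransition.one_of_one_le (by linarith)]
  let e : ℝ ≃o ℝ := hHmono.orderIsoOfSurjective H hsurj
  have heH : ∀ y, e y = H y := fun _ => rfl
  have hG : ContDiff ℝ (⊤ : ℕ∞) e.toHomeomorph.symm := by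
    refine e.toHomeomorph.contDiff_symm_deriv (f' := fun x => 1 + deriv s x) (fun x => ?_)
      (fun x => ?_) hHsmooth
    · have := hmono.deriv_nonneg (x := x)
      positivity
    · exact (hasDerivAt_id x).add (hsmooth.differentiable (by simp) x).hasDerivAt
  refine ⟨e.symm, H, hG, hHsmooth, e.symm.strictMono,
    fun y => e.symm_apply_apply y, fun x hx => ?_, fun x hx => ?_, hH1, hH2⟩
  · rw [e.symm_apply_eq, heH, hH1 x hx]
  · rw [e.symm_apply_eq, heH, hH2 _ (by linarith)]; ring

/-- There are families `f_ε(x) = εx` and `(g_ε)` of smooth strictly increasing bijections of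
`ℝ` with `f_ε = g_ε` on every compact set for small `ε` (so `(f_ε − g_ε)` is locally
negligible), all four families `(f_ε), (g_ε), (f_ε⁻¹), (g_ε⁻¹)` tempered moderate, but
`sup_{[3,4]} |f_ε⁻¹ − g_ε⁻¹| = 1/ε`; in particular `(f_ε⁻¹ − g_ε⁻¹)` is not locally
negligible and `(f_ε − g_ε)` is not tempered negligible. -/
theorem counterexample_inverse_not_negligible :
    ∃ g : ℝ → ℝ → ℝ,
      (∀ ε ∈ Set.Ioc (0:ℝ) 1, ContDiff ℝ (⊤ : ℕ∞) (g ε) ∧ StrictMono (g ε) ∧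
        Function.Bijective (g ε)) ∧
      (∀ K : Set ℝ, IsCompact K → ∃ ε₀ ∈ Set.Ioc (0:ℝ) 1,
        ∀ ε ∈ Set.Ioc (0:ℝ) 1, ε ≤ ε₀ → ∀ x ∈ K, ε * x = g ε x) ∧
      LocNegligible1 (fun ε x => ε * x - g ε x) ∧
      TempModerate (fun ε x => ε * x) ∧ TempModerate g ∧
      TempModerate (fun ε => Function.invFun (fun x => ε * x)) ∧
      TempModerate (fun ε => Function.invFun (g ε)) ∧
      (∀ ε ∈ Set.Ioc (0:ℝ) 1,
        sSup ((fun y => |Function.invFun (fun x => ε * x) y - Function.invFun (g ε) y|) ''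
          Set.Icc (3:ℝ) 4) = 1 / ε) ∧
      ¬ LocNegligible1 (fun ε y =>
          Function.invFun (fun x => ε * x) y - Function.invFun (g ε) y) ∧
      ¬ TempNegligible (fun ε x => ε * x - g ε x) := by
  obtain ⟨G, H, hG, hH, hmono, hGH, hG1, hG3, hH1, hH2⟩ := exists_smooth_shift
  have hGgrowth : DerivsLinearGrowth G :=
    derivsLinearGrowth_of_eq_translation (a := 0) (b := -1) hG (by simpa using hG1)
      (by simpa [sub_eq_add_neg] using hG3)
  have hHgrowth : DerivsLinearGrowth H :=
    derivsLinearGrowth_of_eq_translation (a := 0) (b := 1) hH (by simpa using hH1) hH2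
  have hginj : ∀ ε ∈ Ioc (0 : ℝ) 1, StrictMono fun x => G (ε * x) := fun ε hε =>
    hmono.comp (strictMono_mul_left_of_pos hε.1)
  have hgright : ∀ ε ∈ Ioc (0 : ℝ) 1,
      Function.RightInverse (fun y => H y / ε) fun x => G (ε * x) := fun ε hε y => by
    have := hε.1.ne'
    simp only [mul_div_cancel₀ _ this, hGH y]
  have hinvf : ∀ ε ∈ Ioc (0 : ℝ) 1, Function.invFun (fun x => ε * x) = fun y => y / ε :=
    fun ε hε => Function.invFun_eq_of_injective_of_rightInverse
      (strictMono_mul_left_of_pos hε.1).injective fun y => mul_div_cancel₀ y hε.1.ne'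
  have hinvg : ∀ ε ∈ Ioc (0 : ℝ) 1, Function.invFun (fun x => G (ε * x)) = fun y => H y / ε :=
    fun ε hε => Function.invFun_eq_of_injective_of_rightInverse (hginj ε hε).injective
      (hgright ε hε)
  have hdiff : ∀ ε ∈ Ioc (0 : ℝ) 1, ∀ y ∈ Icc (3 : ℝ) 4,
      |Function.invFun (fun x => ε * x) y - Function.invFun (fun x => G (ε * x)) y| = 1 / ε := by
    intro ε hε y hy
    simp only [hinvf ε hε, hinvg ε hε]
    rw [hH2 y (by linarith [hy.1]), ← sub_div, abs_div, abs_of_pos hε.1]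
    simp
  have hbdd : ∀ R : ℝ, ∃ ε₀ ∈ Ioc (0 : ℝ) 1, ∀ ε ∈ Ioc (0 : ℝ) 1, ε ≤ ε₀ →
      ∀ x, |x| < R → ε * x = G (ε * x) := by
    intro R
    refine ⟨1 / (1 + |R|), ⟨by positivity, ?_⟩, fun ε hε hle x hx => (hG1 _ ?_).symm⟩
    · rw [div_le_one (by positivity)]
      linarith [abs_nonneg R]
    · rw [le_div_iff₀ (by positivity)] at hle
      have : x ≤ 1 + |R| := by linarith [le_abs_self x, le_abs_self R]
      exact (mul_le_mul_of_nonneg_left this hε.1.le).trans hle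
  refine ⟨fun ε x => G (ε * x), fun ε hε => ⟨hG.comp (contDiff_const.mul contDiff_id),
    hginj ε hε, (hginj ε hε).injective, (hgright ε hε).surjective⟩, fun K hK => ?_,
    locNegligible1_of_eventually_zero fun R => ?_,
    derivsLinearGrowth_id.tempModerate_comp_mul contDiff_id,
    hGgrowth.tempModerate_comp_mul hG, derivsLinearGrowth_id.tempModerate_div hinvf,
    hHgrowth.tempModerate_div hinvg, fun ε hε => ?_, fun h => ?_, fun h => ?_⟩
  · obtain ⟨R, hR⟩ := hK.exists_bound_of_continuousOn (f := id) continuousOn_id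
    obtain ⟨ε₀, hε₀, h⟩ := hbdd (R + 1)
    exact ⟨ε₀, hε₀, fun ε hε hle x hx => h ε hε hle x
      (lt_of_le_of_lt (hR x hx) (lt_add_one R))⟩
  · obtain ⟨ε₀, hε₀, h⟩ := hbdd R
    exact ⟨ε₀, hε₀, fun ε hε hle x hx => sub_eq_zero.2 (h ε hε hle x hx)⟩
  · rw [image_congr (hdiff ε hε), Nonempty.image_const ⟨3, by norm_num⟩, csSup_singleton]
  · obtain ⟨C, hC, ε₀, hε₀, h⟩ := h (Icc 3 4) isCompact_Icc 0 0
    have hpos : 0 < min ε₀ (1 / (C + 1)) := lt_min hε₀.1 (by positivity)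
    have hmem : min ε₀ (1 / (C + 1)) ∈ Ioc (0 : ℝ) 1 := ⟨hpos, (min_le_left _ _).trans hε₀.2⟩
    have h3 := h _ hmem (min_le_left _ _) 3 (by norm_num) 0 le_rfl
    rw [iteratedDeriv_zero, hdiff _ hmem 3 (by norm_num), pow_zero, mul_one,
      div_le_iff₀ hpos] at h3
    have h4 := min_le_right ε₀ (1 / (C + 1))
    rw [le_div_iff₀ (by positivity)] at h4
    nlinarith
  · obtain ⟨q, h⟩ := h 0
    obtain ⟨C, hC, ε₀, hε₀, h⟩ := h (q + 1)
    set D : ℝ := C * 5 ^ q with hD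
    have hD0 : 0 < D := by positivity
    obtain ⟨ε, hε⟩ : ∃ ε, ε = min ε₀ (1 / (D + 1)) := ⟨_, rfl⟩
    have hpos : 0 < ε := hε ▸ lt_min hε₀.1 (by positivity)
    have hle : ε ≤ ε₀ := hε ▸ min_le_left _ _
    have h4 : ε ≤ 1 / (D + 1) := hε ▸ min_le_right _ _
    rw [le_div_iff₀ (by positivity)] at h4
    have hε1 : ε ≤ 1 := hle.trans hε₀.2
    have h1 := h ε ⟨hpos, hε1⟩ hle (4 / ε) 0 le_rfl
    simp only [iteratedDeriv_zero] at h1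
    rw [mul_div_cancel₀ _ hpos.ne', hG3 4 (by norm_num),
      abs_of_pos (show 0 < 4 / ε by positivity)] at h1
    have h2 : C * (1 + 4 / ε) ^ q * ε ^ (q + 1) = C * (ε + 4) ^ q * ε := by
      have : ε + 4 = (1 + 4 / ε) * ε := by field_simp
      rw [this, mul_pow]
      ring
    have h5 : C * (ε + 4) ^ q * ε ≤ D * ε := by
      rw [hD]
      gcongr
      linarith
    rw [h2] at h1
    norm_num at h1
    linarith
end
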